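/- Let m, n, ℓ be integers with m ≥ 6, n ≥ m, 0 ≤ ℓ ≤ m, and Δ = 4mn − ℓ². Then |Σ_{γ=1}^∞ √(2m)·d(m)·Kl(Δ/(4m), −1; γ, ψ)_{ℓ0}·γ^{−1/2}·(4m/Δ)⁶·I_12(2π√(Δ/m)/γ)| < 5·10^{−4}·C_pos(Δ, m), where C_pos(Δ, m) = 2π·(m+2)·(2m)^{−1/2}·((4m+m²)/Δ)^{23/4}·I_{23/2}(π√(Δ(4m+m²))/m). -/

import Mathlib

open Real

noncomputable def besselI (ν x : ℝ) : ℝ :=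
  ∑' k : ℕ, (x / 2) ^ (2 * (k : ℝ) + ν) / ((k.factorial : ℝ) * Real.Gamma ((k : ℝ) + ν + 1))

/-- The multiplier system `ψ(γ, δ)_{ℓ̃ℓ}` of the index-`m` theta functions, where
`α` is the inverse of `δ` modulo `γ` (taken in `[0, γ)`). -/
noncomputable def psiMult (m γ : ℕ) (δ : ℤ) (ℓt ℓ : ℤ) : ℂ :=
  (((2 * m * γ : ℕ) : ℂ) * Complex.I) ^ (-(1 / 2 : ℂ)) *
    ∑ T ∈ Finset.range γ,
      Complex.exp (2 * (Real.pi : ℂ) * Complex.I *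
        ((((((δ : ZMod γ)⁻¹).val : ℕ) : ℂ) * ((ℓt : ℂ) - 2 * m * T) ^ 2) / (4 * m * γ)
          - ((ℓ : ℂ) * ((ℓt : ℂ) - 2 * m * T)) / (2 * m * γ)
          + ((δ : ℂ) * (ℓ : ℂ) ^ 2) / (4 * m * γ)))

/-- The generalized Kloosterman sum `Kl(A, B; γ, ψ)_{ℓℓ̃}`: the sum runs over
`δ = -j` with `0 ≤ j < γ` and `gcd(j, γ) = 1`, and `α(δ, γ)` is the inverse of `δ` mod `γ`. -/
noncomputable def Kl (m : ℕ) (A B : ℚ) (γ : ℕ) (ℓ ℓt : ℤ) : ℂ :=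
  ∑ j ∈ (Finset.range γ).filter fun j => Nat.gcd j γ = 1,
    Complex.exp (2 * (Real.pi : ℂ) * Complex.I *
      (((((-(j : ℤ) : ZMod γ)⁻¹).val : ℕ) : ℂ) * (B : ℂ) / γ + ((-(j : ℤ) : ℤ) : ℂ) * (A : ℂ) / γ)) *
    psiMult m γ (-(j : ℤ)) ℓt ℓ

/-- `d n`: the coefficient of `q^(n+1)` in `∏ (1 - q^j)^{-24}`. -/
def dcoef (n : ℤ) : ℤ :=
  if 0 ≤ n + 1 then
    ∑ v ∈ Finset.Nat.antidiagonalTuple 24 (n + 1).toNat,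
      ∏ i, (Fintype.card (Nat.Partition (v i)) : ℤ)
  else 0

/-- `C_pos(Δ, m) = 2π(m+2)(2m)^{-1/2}((4m+m²)/Δ)^{23/4} I_{23/2}(π√(Δ(4m+m²))/m)`. -/
noncomputable def Cpos (m : ℕ) (Δ : ℤ) : ℝ :=
  2 * Real.pi * ((m : ℝ) + 2) * (2 * (m : ℝ)) ^ (-(1 / 2 : ℝ)) *
    ((4 * (m : ℝ) + (m : ℝ) ^ 2) / (Δ : ℝ)) ^ ((23 : ℝ) / 4) *
    besselI (23 / 2) (Real.pi * Real.sqrt ((Δ : ℝ) * (4 * (m : ℝ) + (m : ℝ) ^ 2)) / m)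

open PowerSeries in
/-- Sums of products over `antidiagonalTuple` are coefficients of powers of a power series. -/
theorem sum_antidiagonalTuple_prod_eq_coeff_pow {R : Type*} [CommSemiring R] (g : ℕ → R)
    (k n : ℕ) :
    ∑ v ∈ Finset.Nat.antidiagonalTuple k n, ∏ i, g (v i) = coeff n ((PowerSeries.mk g) ^ k) := by
  have h : (PowerSeries.mk g) ^ k = ∏ _i : Fin k, PowerSeries.mk g := by simp
  rw [h, PowerSeries.coeff_prod]
  refine Finset.sum_bij' (fun v _ => Finsupp.equivFunOnFinite.symm v) (fun l _ => ⇑l) ?_ ?_ ?_ ?_ ?_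
  · intro v hv
    simpa [Finset.mem_finsuppAntidiag, Finset.Nat.mem_antidiagonalTuple] using hv
  · intro l hl
    simpa [Finset.mem_finsuppAntidiag, Finset.Nat.mem_antidiagonalTuple] using hl
  · intro v _
    rfl
  · intro l _
    ext
    rfl
  · intro v _
    simp

theorem card_partition_le_two_pow (n : ℕ) : Fintype.card (Nat.Partition n) ≤ 2 ^ (n - 1) := by
  rw [← composition_card]
  exact Fintype.card_le_of_surjective _ Nat.Partition.ofComposition_surj

/-- The generating function `(1 - X) / (1 - 2 X)` of the number of compositions. -/
noncomputable def compositionSeries : PowerSeries ℝ :=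
  PowerSeries.mk fun n => 2 ^ (n - 1)

/-- The coefficients of the 24th power of the generating function of compositions. -/
noncomputable def compCoeff (n : ℕ) : ℝ := PowerSeries.coeff n (compositionSeries ^ 24)

theorem compCoeff_eq (n : ℕ) :
    compCoeff n = ∑ v ∈ Finset.Nat.antidiagonalTuple 24 n, ∏ i, (2 : ℝ) ^ (v i - 1) :=
  (sum_antidiagonalTuple_prod_eq_coeff_pow (fun n => (2 : ℝ) ^ (n - 1)) 24 n).symm

theorem compCoeff_nonneg (n : ℕ) : 0 ≤ compCoeff n := by
  rw [compCoeff_eq]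
  positivity

theorem dcoef_nonneg (n : ℤ) : 0 ≤ dcoef n := by
  unfold dcoef
  split_ifs
  · positivity
  · exact le_rfl

theorem dcoef_le_compCoeff (m : ℕ) : (dcoef m : ℝ) ≤ compCoeff (m + 1) := by
  have h : ((m : ℤ) + 1).toNat = m + 1 := by omega
  rw [compCoeff_eq, dcoef, if_pos (by omega), h]
  push_cast
  refine Finset.sum_le_sum fun v _ => Finset.prod_le_prod (fun _ _ => by positivity) fun i _ => ?_
  exact_mod_cast card_partition_le_two_pow (v i)

open PowerSeries in
theorem one_sub_two_X_mul_compositionSeries :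
    (1 - 2 * X) * compositionSeries = 1 - (X : PowerSeries ℝ) := by
  have h2 : (2 : PowerSeries ℝ) = C 2 := (map_ofNat C 2).symm
  ext n
  rw [sub_mul, one_mul, mul_assoc, map_sub, map_sub, h2, coeff_C_mul]
  rcases n with _ | _ | n
  · simp [compositionSeries]
  · simp [compositionSeries, coeff_succ_X_mul, coeff_one]
    norm_num
  · simp [compositionSeries, coeff_succ_X_mul, coeff_one, coeff_X]
    ring

open PowerSeries in
theorem derivative_compositionSeries_pow :
    (1 - X) * ((1 - 2 * X) * d⁄dX ℝ (compositionSeries ^ 24)) = 24 * compositionSeries ^ 24 := by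
  have h := one_sub_two_X_mul_compositionSeries
  have h2 : d⁄dX ℝ (2 : PowerSeries ℝ) = 0 := by
    have : (2 : PowerSeries ℝ) = C 2 := (map_ofNat C 2).symm
    rw [this, derivative_C]
  have hd : (1 - 2 * X) * d⁄dX ℝ compositionSeries - 2 * compositionSeries = -1 := by
    have := congrArg (d⁄dX ℝ) h
    simp only [Derivation.leibniz, map_sub, derivative_one, derivative_X, smul_eq_mul, h2] at this
    linear_combination this
  have hf : (1 - X) * ((1 - 2 * X) * d⁄dX ℝ compositionSeries) = compositionSeries := by
    have hd' : (1 - 2 * X) * ((1 - 2 * X) * d⁄dX ℝ compositionSeries) = 1 := by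
      linear_combination (1 - 2 * X) * hd + 2 * h
    linear_combination compositionSeries * hd' - (1 - 2 * X) * d⁄dX ℝ compositionSeries * h
  rw [derivative_pow]
  push_cast
  linear_combination 24 * compositionSeries ^ 23 * hf

open PowerSeries in
theorem compCoeff_recurrence (n : ℕ) :
    ((n : ℝ) + 2) * compCoeff (n + 2) =
      (3 * n + 27) * compCoeff (n + 1) - 2 * n * compCoeff n := by
  have h := derivative_compositionSeries_pow
  have h' : d⁄dX ℝ (compositionSeries ^ 24) - C 3 * (X * d⁄dX ℝ (compositionSeries ^ 24))
      + C 2 * (X * (X * d⁄dX ℝ (compositionSeries ^ 24))) = C 24 * compositionSeries ^ 24 := by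
    simp only [map_ofNat]
    linear_combination h
  rcases n with _ | n
  · have := congrArg (coeff (0 + 1)) h'
    simp only [map_add, map_sub, coeff_C_mul, coeff_succ_X_mul, coeff_derivative,
      coeff_zero_X_mul] at this
    simp only [compCoeff]
    push_cast at this ⊢
    linarith
  · have := congrArg (coeff (n + 2)) h'
    simp only [map_add, map_sub, coeff_C_mul, coeff_succ_X_mul, coeff_derivative] at this
    simp only [compCoeff, show n + 1 + 2 = n + 2 + 1 by omega]
    push_cast at this ⊢
    linarith

theorem compCoeff_zero : compCoeff 0 = 1 := by
  rw [compCoeff_eq, Finset.Nat.antidiagonalTuple_zero_right]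
  simp

open PowerSeries in
theorem compCoeff_one : compCoeff 1 = 24 := by
  have := congrArg (coeff 0) derivative_compositionSeries_pow
  simp only [coeff_zero_eq_constantCoeff, map_mul, map_sub, map_one, constantCoeff_X, mul_zero,
    sub_zero, one_mul, map_ofNat] at this
  rw [← coeff_zero_eq_constantCoeff_apply, ← coeff_zero_eq_constantCoeff_apply,
    coeff_derivative, ← compCoeff, ← compCoeff, compCoeff_zero] at this
  simpa using this

theorem compCoeff_seven : compCoeff 7 = 6751944 := by
  have h0 := compCoeff_recurrence 0
  have h1 := compCoeff_recurrence 1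
  have h2 := compCoeff_recurrence 2
  have h3 := compCoeff_recurrence 3
  have h4 := compCoeff_recurrence 4
  have h5 := compCoeff_recurrence 5
  have := compCoeff_one
  norm_num at h0 h1 h2 h3 h4 h5
  linarith

theorem compCoeff_succ_le {n : ℕ} (hn : 7 ≤ n) : compCoeff (n + 1) ≤ 45 / 8 * compCoeff n := by
  obtain ⟨k, rfl⟩ : ∃ k, n = k + 1 := ⟨n - 1, by omega⟩
  have hk : (6 : ℝ) ≤ k := by exact_mod_cast (by omega : 6 ≤ k)
  have h := compCoeff_recurrence k
  have h0 := compCoeff_nonneg k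
  have h1 := compCoeff_nonneg (k + 1)
  have h2 : ((k : ℝ) + 2) * compCoeff (k + 2) ≤ (k + 2) * (45 / 8 * compCoeff (k + 1)) := by
    rw [h]
    nlinarith [mul_nonneg (by linarith : (0 : ℝ) ≤ k) h0,
      mul_nonneg (by linarith : (0 : ℝ) ≤ k - 6) h1]
  exact le_of_mul_le_mul_left h2 (by linarith)

/-- The Taylor coefficients of the entire function `I_ν(2√z) / z^{ν/2}`. -/
noncomputable def besselCoeff (ν : ℝ) (k : ℕ) : ℝ :=
  1 / ((k.factorial : ℝ) * Real.Gamma ((k : ℝ) + ν + 1))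

/-- The entire function `I_ν(2√z) / z^{ν/2}`. -/
noncomputable def besselEntire (ν z : ℝ) : ℝ := ∑' k : ℕ, besselCoeff ν k * z ^ k

theorem besselCoeff_pos {ν : ℝ} (hν : 0 ≤ ν) (k : ℕ) : 0 < besselCoeff ν k := by
  have : 0 < Real.Gamma ((k : ℝ) + ν + 1) := Real.Gamma_pos_of_pos (by positivity)
  unfold besselCoeff
  positivity

theorem besselCoeff_le {ν : ℝ} (hν : 1 ≤ ν) (k : ℕ) :
    besselCoeff ν k ≤ 1 / (k.factorial : ℝ) := by
  have hk : (0 : ℝ) ≤ k := k.cast_nonneg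
  have h : 1 ≤ Real.Gamma ((k : ℝ) + ν + 1) := by
    refine Real.Gamma_two.symm.trans_le ?_
    exact Real.Gamma_strictMonoOn_Ici.monotoneOn (Set.mem_Ici.2 le_rfl)
      (Set.mem_Ici.2 (by linarith)) (by linarith)
  unfold besselCoeff
  have : (0 : ℝ) < k.factorial := by exact_mod_cast k.factorial_pos
  exact one_div_le_one_div_of_le this (by nlinarith)

theorem besselCoeff_succ {ν : ℝ} (hν : 0 ≤ ν) (k : ℕ) :
    besselCoeff ν (k + 1) = besselCoeff ν k / (((k : ℝ) + 1) * (k + ν + 1)) := by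
  have h1 : (k : ℝ) + ν + 1 ≠ 0 := by positivity
  have h2 : Real.Gamma ((k : ℝ) + ν + 1) ≠ 0 := (Real.Gamma_pos_of_pos (by positivity)).ne'
  have h3 : ((k + 1 : ℕ) : ℝ) + ν + 1 = (k + ν + 1) + 1 := by push_cast; ring
  unfold besselCoeff
  rw [h3, Real.Gamma_add_one h1, Nat.factorial_succ]
  push_cast
  field_simp

theorem summable_besselCoeff_mul_pow {ν z : ℝ} (hν : 1 ≤ ν) (hz : 0 ≤ z) :
    Summable fun k : ℕ => besselCoeff ν k * z ^ k := by
  refine Summable.of_nonneg_of_le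
    (fun k => mul_nonneg (besselCoeff_pos (by linarith) k).le (pow_nonneg hz k)) (fun k => ?_)
    (Real.summable_pow_div_factorial z)
  calc besselCoeff ν k * z ^ k ≤ 1 / (k.factorial : ℝ) * z ^ k :=
        mul_le_mul_of_nonneg_right (besselCoeff_le hν k) (pow_nonneg hz k)
    _ = z ^ k / k.factorial := by ring

theorem besselEntire_pos {ν z : ℝ} (hν : 1 ≤ ν) (hz : 0 ≤ z) : 0 < besselEntire ν z := by
  have h0 : ∀ k : ℕ, 0 ≤ besselCoeff ν k * z ^ k := fun k =>
    mul_nonneg (besselCoeff_pos (by linarith) k).le (pow_nonneg hz k)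
  exact (summable_besselCoeff_mul_pow hν hz).tsum_pos h0 0
    (by simpa using besselCoeff_pos (by linarith) 0)

theorem besselI_eq_besselEntire (ν : ℝ) {x : ℝ} (hx : 0 < x) :
    besselI ν x = (x / 2) ^ ν * besselEntire ν ((x / 2) ^ 2) := by
  unfold besselI besselEntire
  rw [← tsum_mul_left]
  refine tsum_congr fun k => ?_
  have h : (x / 2) ^ (2 * (k : ℝ) + ν) = ((x / 2) ^ 2) ^ k * (x / 2) ^ ν := by
    rw [Real.rpow_add (by positivity), ← pow_mul, ← Real.rpow_natCast]
    push_cast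
    rfl
  rw [h, besselCoeff]
  ring

theorem besselEntire_mono {ν z w : ℝ} (hν : 1 ≤ ν) (hz : 0 ≤ z) (hzw : z ≤ w) :
    besselEntire ν z ≤ besselEntire ν w := by
  refine (summable_besselCoeff_mul_pow hν hz).tsum_le_tsum (fun k => ?_)
    (summable_besselCoeff_mul_pow hν (hz.trans hzw))
  exact mul_le_mul_of_nonneg_left (pow_le_pow_left₀ hz hzw k) (besselCoeff_pos (by linarith) k).le

/-- A lower bound for the logarithmic derivative of `besselEntire`. -/
theorem mul_besselEntire_le_tsum {ν w κ : ℝ} (hν : 1 ≤ ν) (hκ : 0 ≤ κ)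
    (hw : κ * (κ + ν + 1) ≤ w) :
    Summable (fun k : ℕ => (k : ℝ) * (besselCoeff ν k * w ^ k)) ∧
      κ * besselEntire ν w ≤ ∑' k : ℕ, (k : ℝ) * (besselCoeff ν k * w ^ k) := by
  have hw0 : 0 ≤ w := le_trans (by positivity) hw
  have hS := summable_besselCoeff_mul_pow hν hw0
  have h0 : ∀ k : ℕ, 0 ≤ besselCoeff ν k * w ^ k := fun k =>
    mul_nonneg (besselCoeff_pos (by linarith) k).le (pow_nonneg hw0 k)
  have hshift : ∀ k : ℕ, ((k + 1 : ℕ) : ℝ) * (besselCoeff ν (k + 1) * w ^ (k + 1)) =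
      w * (besselCoeff ν k * w ^ k / (k + ν + 1)) := by
    intro k
    have h1 : (k : ℝ) + ν + 1 ≠ 0 := by positivity
    have h2 : (k : ℝ) + 1 ≠ 0 := by positivity
    rw [besselCoeff_succ (by linarith)]
    push_cast
    field_simp
    ring
  have hT : Summable fun k : ℕ => besselCoeff ν k * w ^ k / ((k : ℝ) + ν + 1) := by
    refine Summable.of_nonneg_of_le (fun k => div_nonneg (h0 k) (by positivity)) (fun k => ?_) hS
    refine div_le_self (h0 k) ?_
    have hk : (0 : ℝ) ≤ k := k.cast_nonneg
    linarith
  have hM : Summable fun k : ℕ => (k : ℝ) * (besselCoeff ν k * w ^ k) := by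
    rw [← summable_nat_add_iff 1]
    exact (hT.mul_left w).congr fun k => (hshift k).symm
  refine ⟨hM, ?_⟩
  have hMeq : ∑' k : ℕ, (k : ℝ) * (besselCoeff ν k * w ^ k) =
      w * ∑' k : ℕ, besselCoeff ν k * w ^ k / ((k : ℝ) + ν + 1) := by
    rw [hM.tsum_eq_zero_add, ← tsum_mul_left]
    simp only [hshift]
    simp
  set M := ∑' k : ℕ, (k : ℝ) * (besselCoeff ν k * w ^ k) with hMdef
  set c := κ + ν + 1 with hc
  have hc0 : 0 < c := by positivity
  have hE0 := besselEntire_pos hν hw0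
  have hlin : 2 / c * besselEntire ν w - (M + (ν + 1) * besselEntire ν w) / c ^ 2 ≤
      ∑' k : ℕ, besselCoeff ν k * w ^ k / ((k : ℝ) + ν + 1) := by
    have hsum := (hS.hasSum.mul_left (2 / c)).sub
      ((hM.hasSum.add (hS.hasSum.mul_left (ν + 1))).div_const (c ^ 2))
    refine hasSum_le (fun k => ?_) hsum hT.hasSum
    have hd : (0 : ℝ) < k + ν + 1 := by positivity
    have key : 2 / c - (k + ν + 1) / c ^ 2 ≤ 1 / ((k : ℝ) + ν + 1) := by
      rw [← sub_nonneg]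
      have : 1 / ((k : ℝ) + ν + 1) - (2 / c - (k + ν + 1) / c ^ 2) =
          (c - (k + ν + 1)) ^ 2 / (c ^ 2 * (k + ν + 1)) := by
        field_simp
        ring
      rw [this]
      positivity
    calc _ = besselCoeff ν k * w ^ k * (2 / c - (k + ν + 1) / c ^ 2) := by ring
      _ ≤ besselCoeff ν k * w ^ k * (1 / ((k : ℝ) + ν + 1)) :=
          mul_le_mul_of_nonneg_left key (h0 k)
      _ = _ := by ring
  have h1 : w * (2 / c * besselEntire ν w - (M + (ν + 1) * besselEntire ν w) / c ^ 2) ≤ M := by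
    exact (mul_le_mul_of_nonneg_left hlin hw0).trans_eq hMeq.symm
  have h2 : w * (2 * c - (ν + 1)) * besselEntire ν w ≤ M * (c ^ 2 + w) := by
    have : w * (2 / c * besselEntire ν w - (M + (ν + 1) * besselEntire ν w) / c ^ 2) * c ^ 2 =
        w * (2 * c - (ν + 1)) * besselEntire ν w - w * M := by
      field_simp
      ring
    nlinarith [mul_le_mul_of_nonneg_right h1 (sq_nonneg c)]
  have h3 : κ * (c ^ 2 + w) ≤ w * (2 * c - (ν + 1)) := by
    nlinarith [mul_le_mul_of_nonneg_right hw hc0.le]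
  have h4 : κ * besselEntire ν w * (c ^ 2 + w) ≤ M * (c ^ 2 + w) := by
    nlinarith [mul_le_mul_of_nonneg_right h3 hE0.le]
  exact le_of_mul_le_mul_right h4 (by positivity)

/-- A lower bound for the growth of `besselEntire` under scaling of its argument. -/
theorem rpow_mul_besselEntire_le {ν w κ s : ℝ} (hν : 1 ≤ ν) (hκ : 0 ≤ κ)
    (hw : κ * (κ + ν + 1) ≤ w) (hs : 1 ≤ s) :
    s ^ κ * besselEntire ν w ≤ besselEntire ν (s * w) := by
  have hw0 : 0 ≤ w := le_trans (by positivity) hw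
  have hs0 : 0 < s := by linarith
  obtain ⟨hM, hle⟩ := mul_besselEntire_le_tsum hν hκ hw
  have hS := summable_besselCoeff_mul_pow hν hw0
  have hsum := ((hS.hasSum.add ((hM.hasSum.sub (hS.hasSum.mul_left κ)).mul_left
    (Real.log s))).mul_left (s ^ κ))
  have hR := (summable_besselCoeff_mul_pow hν (mul_nonneg hs0.le hw0)).hasSum
  refine le_trans ?_ (hasSum_le (fun k => ?_) hsum hR)
  · refine mul_le_mul_of_nonneg_left ?_ (by positivity)
    have := mul_nonneg (Real.log_nonneg hs) (sub_nonneg.2 hle)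
    unfold besselEntire at *
    linarith
  · have hpow : s ^ κ * (1 + Real.log s * (k - κ)) ≤ s ^ k := by
      have h1 : s ^ k = s ^ κ * Real.exp (Real.log s * (k - κ)) := by
        rw [← Real.rpow_def_of_pos hs0, ← Real.rpow_add hs0, ← Real.rpow_natCast]
        congr 1
        ring
      rw [h1]
      refine mul_le_mul_of_nonneg_left ?_ (by positivity)
      linarith [Real.add_one_le_exp (Real.log s * (k - κ))]
    have h0 : 0 ≤ besselCoeff ν k * w ^ k :=
      mul_nonneg (besselCoeff_pos (by linarith) k).le (pow_nonneg hw0 k)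
    rw [mul_pow]
    nlinarith [mul_le_mul_of_nonneg_right hpow h0]

/-- If the coefficients of a power series change sign only once, from negative to nonnegative,
then positivity of the sum propagates to larger arguments. -/
theorem tsum_mul_pow_pos_of_sign_change {c : ℕ → ℝ} {z w : ℝ} (hz : 0 < z) (hzw : z ≤ w)
    (hc : ∀ k, 0 ≤ c k → 0 ≤ c (k + 1)) (hsz : Summable fun k => c k * z ^ k)
    (hsw : Summable fun k => c k * w ^ k) (hpos : 0 < ∑' k, c k * z ^ k) :
    0 < ∑' k, c k * w ^ k := by
  classical
  have hex : ∃ k, 0 ≤ c k := by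
    by_contra! h
    refine absurd hpos (not_lt.2 (tsum_nonpos fun k => ?_))
    exact mul_nonpos_of_nonpos_of_nonneg (h k).le (by positivity)
  have hK := Nat.find_spec hex
  set K := Nat.find hex with hKdef
  have hge : ∀ k, K ≤ k → 0 ≤ c k := fun k hk => Nat.le_induction hK (fun n _ h => hc n h) k hk
  have hlt : ∀ k, k < K → c k ≤ 0 := fun k hk => (not_le.1 (Nat.find_min hex hk)).le
  have hs : 1 ≤ w / z := by rwa [one_le_div hz]
  have hmain : (w / z) ^ K * ∑' k, c k * z ^ k ≤ ∑' k, c k * w ^ k := by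
    rw [← tsum_mul_left]
    refine (hsz.mul_left _).tsum_le_tsum (fun k => ?_) hsw
    have hwk : w ^ k = (w / z) ^ k * z ^ k := by
      rw [← mul_pow, div_mul_cancel₀ _ hz.ne']
    rw [hwk]
    have hzk : 0 ≤ z ^ k := by positivity
    rcases lt_or_ge k K with h | h
    · have := pow_le_pow_right₀ hs h.le
      nlinarith [mul_nonneg (mul_nonneg (neg_nonneg.2 (hlt k h)) hzk) (sub_nonneg.2 this)]
    · have := pow_le_pow_right₀ hs h
      nlinarith [mul_nonneg (mul_nonneg (hge k h) hzk) (sub_nonneg.2 this)]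
  exact lt_of_lt_of_le (mul_pos (by positivity) hpos) hmain

theorem besselCoeff_twelve (k : ℕ) :
    besselCoeff 12 k = 1 / ((k.factorial : ℝ) * (k + 12).factorial) := by
  rw [besselCoeff, ← Real.Gamma_nat_eq_factorial (k + 12)]
  push_cast
  rfl

theorem sqrt_pi_mul_besselCoeff (k : ℕ) :
    √π * besselCoeff (23 / 2) k =
      4 ^ (k + 12) * (k + 12).factorial / ((k.factorial : ℝ) * (2 * k + 24).factorial) := by
  have h := Real.Gamma_mul_Gamma_add_half (((k + 12 : ℕ) : ℝ) + 1 / 2)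
  have h1 : ((k + 12 : ℕ) : ℝ) + 1 / 2 + 1 / 2 = ((k + 12 : ℕ) : ℝ) + 1 := by ring
  have h2 : 2 * (((k + 12 : ℕ) : ℝ) + 1 / 2) = ((2 * k + 24 : ℕ) : ℝ) + 1 := by push_cast; ring
  have h3 : (1 : ℝ) - (((2 * k + 24 : ℕ) : ℝ) + 1) = -((2 * (k + 12) : ℕ) : ℝ) := by
    push_cast; ring
  rw [h1, h2, h3, Real.Gamma_nat_eq_factorial, Real.Gamma_nat_eq_factorial,
    Real.rpow_neg (by norm_num), Real.rpow_natCast, pow_mul] at h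
  have h4 : (k : ℝ) + 23 / 2 + 1 = ((k + 12 : ℕ) : ℝ) + 1 / 2 := by push_cast; ring
  have h5 : 0 < Real.Gamma (((k + 12 : ℕ) : ℝ) + 1 / 2) := Real.Gamma_pos_of_pos (by positivity)
  rw [besselCoeff, h4]
  generalize Real.Gamma (((k + 12 : ℕ) : ℝ) + 1 / 2) = G at h h5
  have hk : (0 : ℝ) < k.factorial := by exact_mod_cast k.factorial_pos
  have hN : (0 : ℝ) < (2 * k + 24).factorial := by exact_mod_cast (2 * k + 24).factorial_pos
  have hpow : (0 : ℝ) < (2 ^ 2) ^ (k + 12) := by positivity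
  generalize ((2 * k + 24).factorial : ℝ) = N at h hN
  generalize ((k + 12).factorial : ℝ) = M at h
  rw [show (4 : ℝ) = 2 ^ 2 by norm_num]
  generalize ((2 : ℝ) ^ 2) ^ (k + 12) = E at h hpow
  have h6 : G * M * E = N * √π := by
    rw [h]
    field_simp
  rw [mul_one_div, div_eq_div_iff (by positivity) (by positivity)]
  linear_combination -(k.factorial : ℝ) * h6

/-- The `m`-dependent prefactor of `Cpos`, up to a power of `π`. -/
noncomputable def posWeight (m : ℕ) : ℝ :=
  ((m : ℝ) + 2) / √(2 * m) * (((m : ℝ) + 4) / 2) ^ (23 / 2 : ℝ)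

theorem posWeight_nonneg (m : ℕ) : 0 ≤ posWeight m := by
  unfold posWeight
  positivity

theorem posWeight_six : 8 * (645 / 1000) * 5 ^ 11 ≤ posWeight 6 := by
  have h5 : (5 : ℝ) ^ (23 / 2 : ℝ) = 5 ^ 11 * √5 := by
    rw [Real.sqrt_eq_rpow, ← Real.rpow_natCast, ← Real.rpow_add (by norm_num)]
    norm_num
  have h : (645 / 1000 : ℝ) ≤ √5 / √12 := by
    rw [← Real.sqrt_div (by norm_num)]
    exact Real.le_sqrt_of_sq_le (by norm_num)
  have hW : posWeight 6 = 8 * (√5 / √12) * 5 ^ 11 := by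
    unfold posWeight
    norm_num
    rw [h5]
    ring
  rw [hW]
  gcongr

theorem posWeight_succ_ge {m : ℕ} (hm : 2 ≤ m) :
    (((m : ℝ) + 5) / (m + 4)) ^ (23 / 2 : ℝ) * posWeight m ≤ posWeight (m + 1) := by
  have hm' : (2 : ℝ) ≤ m := by exact_mod_cast hm
  have h1 : ((m : ℝ) + 2) / √(2 * m) ≤ (m + 3) / √(2 * (m + 1)) := by
    rw [div_le_div_iff₀ (by positivity) (by positivity)]
    refine abs_le_of_sq_le_sq' ?_ (by positivity) |>.2
    rw [mul_pow, mul_pow, Real.sq_sqrt (by positivity), Real.sq_sqrt (by positivity)]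
    nlinarith
  have h2 : (((m : ℝ) + 5) / (m + 4)) ^ (23 / 2 : ℝ) * (((m : ℝ) + 4) / 2) ^ (23 / 2 : ℝ) =
      (((m : ℝ) + 5) / 2) ^ (23 / 2 : ℝ) := by
    rw [← Real.mul_rpow (by positivity) (by positivity)]
    congr 1
    field_simp
  have h3 : posWeight (m + 1) =
      ((m : ℝ) + 3) / √(2 * (m + 1)) * (((m : ℝ) + 5) / 2) ^ (23 / 2 : ℝ) := by
    unfold posWeight
    push_cast
    ring_nf
  rw [h3, ← h2, posWeight]
  calc _ = ((m : ℝ) + 2) / √(2 * m) * ((((m : ℝ) + 5) / (m + 4)) ^ (23 / 2 : ℝ) *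
        (((m : ℝ) + 4) / 2) ^ (23 / 2 : ℝ)) := by ring
    _ ≤ _ := mul_le_mul_of_nonneg_right h1 (by positivity)

/-- The `k`-th coefficient of the difference of the two sides of the main estimate. -/
noncomputable def diffCoeff (P Q t : ℝ) (k : ℕ) : ℝ :=
  P * t ^ k * besselCoeff (23 / 2) k - Q * besselCoeff 12 k

theorem diffCoeff_succ_nonneg {P Q t : ℝ} (hP : 0 ≤ P) (ht : 1 ≤ t) (k : ℕ)
    (h : 0 ≤ diffCoeff P Q t k) : 0 ≤ diffCoeff P Q t (k + 1) := by
  unfold diffCoeff at *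
  have ha := (besselCoeff_pos (by norm_num : (0 : ℝ) ≤ 23 / 2) k).le
  rw [besselCoeff_succ (by norm_num), besselCoeff_succ (by norm_num)]
  have hX : 0 ≤ P * t ^ k * besselCoeff (23 / 2) k := by positivity
  have h1 : Q * besselCoeff 12 k / (((k : ℝ) + 1) * (k + 12 + 1)) ≤
      P * t ^ k * besselCoeff (23 / 2) k / (((k : ℝ) + 1) * (k + 12 + 1)) :=
    div_le_div_of_nonneg_right (by linarith) (by positivity)
  have h2 : P * t ^ k * besselCoeff (23 / 2) k / (((k : ℝ) + 1) * (k + 12 + 1)) ≤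
      t * (P * t ^ k * besselCoeff (23 / 2) k) / (((k : ℝ) + 1) * (k + 23 / 2 + 1)) := by
    refine div_le_div₀ (by positivity) (by nlinarith) (by positivity) ?_
    gcongr
    norm_num
  have h3 : P * t ^ (k + 1) * (besselCoeff (23 / 2) k / (((k : ℝ) + 1) * (k + 23 / 2 + 1))) =
      t * (P * t ^ k * besselCoeff (23 / 2) k) / (((k : ℝ) + 1) * (k + 23 / 2 + 1)) := by
    ring
  rw [h3, mul_div_assoc' Q]
  linarith

theorem hasSum_diffCoeff (P Q : ℝ) {t z : ℝ} (ht : 0 ≤ t) (hz : 0 ≤ z) :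
    HasSum (fun k => diffCoeff P Q t k * z ^ k)
      (P * besselEntire (23 / 2) (t * z) - Q * besselEntire 12 z) := by
  have h1 := (summable_besselCoeff_mul_pow (by norm_num : (1 : ℝ) ≤ 23 / 2)
    (mul_nonneg ht hz)).hasSum.mul_left P
  have h2 := (summable_besselCoeff_mul_pow (by norm_num : (1 : ℝ) ≤ 12) hz).hasSum.mul_left Q
  refine (h1.sub h2).congr_fun ?_
  intro k
  simp only [diffCoeff, mul_pow]
  ring

theorem besselEntire_lt_of_le {P Q t z w : ℝ} (hP : 0 ≤ P) (ht : 1 ≤ t) (hz : 0 < z) (hzw : z ≤ w)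
    (h : Q * besselEntire 12 z < P * besselEntire (23 / 2) (t * z)) :
    Q * besselEntire 12 w < P * besselEntire (23 / 2) (t * w) := by
  have ht0 : 0 ≤ t := by linarith
  have h1 := hasSum_diffCoeff P Q ht0 hz.le
  have h2 := hasSum_diffCoeff P Q ht0 (hz.le.trans hzw)
  have := tsum_mul_pow_pos_of_sign_change hz hzw (diffCoeff_succ_nonneg hP ht) h1.summable
    h2.summable (by rw [h1.tsum_eq]; linarith)
  rw [h2.tsum_eq] at this
  linarith

theorem besselEntire_estimate_six :
    8192 * compCoeff 7 * besselEntire 12 168 <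
      √π / 1000 * posWeight 6 * besselEntire (23 / 2) (5 / 2 * 168) := by
  set P := √π / 1000 * posWeight 6 with hP
  set Q := 8192 * compCoeff 7 with hQ
  have hP0 : 0 ≤ P := by have := posWeight_nonneg 6; positivity
  have hterm : ∀ k : ℕ, (8 * (645 / 1000) * 5 ^ 11 / 1000) * (5 / 2) ^ k *
      (4 ^ (k + 12) * (k + 12).factorial / ((k.factorial : ℝ) * (2 * k + 24).factorial)) -
      8192 * 6751944 * (1 / ((k.factorial : ℝ) * (k + 12).factorial)) ≤
      diffCoeff P Q (5 / 2) k := by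
    intro k
    rw [diffCoeff, besselCoeff_twelve, hQ, compCoeff_seven, ← sqrt_pi_mul_besselCoeff, hP]
    have hb := (besselCoeff_pos (by norm_num : (0 : ℝ) ≤ 23 / 2) k).le
    have hX : 0 ≤ √π * besselCoeff (23 / 2) k * (5 / 2) ^ k := by positivity
    nlinarith [mul_le_mul_of_nonneg_right posWeight_six hX]
  have h20 : 0 ≤ diffCoeff P Q (5 / 2) 20 := by
    refine le_trans ?_ (hterm 20)
    norm_num [Nat.factorial]
  have hge : ∀ k, 20 ≤ k → 0 ≤ diffCoeff P Q (5 / 2) k := fun k hk =>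
    Nat.le_induction h20 (fun n _ h => diffCoeff_succ_nonneg hP0 (by norm_num) n h) k hk
  have hsum := hasSum_diffCoeff P Q (by norm_num : (0 : ℝ) ≤ 5 / 2) (by norm_num : (0 : ℝ) ≤ 168)
  have hpart : 0 < ∑ k ∈ Finset.range 20, diffCoeff P Q (5 / 2) k * 168 ^ k := by
    refine lt_of_lt_of_le ?_ (Finset.sum_le_sum fun k _ =>
      mul_le_mul_of_nonneg_right (hterm k) (by positivity : (0 : ℝ) ≤ 168 ^ k))
    norm_num [Finset.sum_range_succ, Nat.factorial]
  have := sum_le_hasSum (Finset.range 20) (fun k hk => mul_nonneg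
    (hge k (by simpa using hk)) (by positivity)) hsum
  linarith

theorem le_one_add_inv_rpow {M : ℕ} (hM : 1 ≤ M) :
    45 / 8 ≤ (((M : ℝ) + 1) / M) ^ (5 / 2 * (M : ℝ)) := by
  have hM' : (1 : ℝ) ≤ M := by exact_mod_cast hM
  have h1 : (2 : ℝ) ≤ (((M : ℝ) + 1) / M) ^ M := by
    have := one_add_mul_le_pow (a := 1 / (M : ℝ)) (by have : 0 ≤ 1 / (M : ℝ) := by positivity
                                                      linarith) M
    have h2 : 1 + (M : ℝ) * (1 / M) = 2 := by field_simp; norm_num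
    have h3 : 1 + 1 / (M : ℝ) = (M + 1) / M := by field_simp
    rwa [h2, h3] at this
  have h2 : (45 / 8 : ℝ) ≤ 2 ^ (5 / 2 : ℝ) := by
    have : (2 : ℝ) ^ (5 / 2 : ℝ) = √32 := by
      rw [Real.sqrt_eq_rpow, show (32 : ℝ) = 2 ^ (5 : ℝ) by norm_num, ← Real.rpow_mul (by norm_num)]
      norm_num
    rw [this]
    exact Real.le_sqrt_of_sq_le (by norm_num)
  calc (45 / 8 : ℝ) ≤ 2 ^ (5 / 2 : ℝ) := h2
    _ ≤ ((((M : ℝ) + 1) / M) ^ M) ^ (5 / 2 : ℝ) :=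
        Real.rpow_le_rpow (by norm_num) h1 (by norm_num)
    _ = _ := by
        rw [← Real.rpow_natCast, ← Real.rpow_mul (by positivity)]
        congr 1
        ring

theorem besselEntire_estimate {m : ℕ} (hm : 6 ≤ m) :
    8192 * compCoeff (m + 1) * besselEntire 12 (28 * m) <
      √π / 1000 * posWeight m * besselEntire (23 / 2) (((m : ℝ) + 4) / 4 * (28 * m)) := by
  induction m, hm using Nat.le_induction with
  | base =>
    have h := besselEntire_estimate_six
    norm_num at h ⊢
    exact h
  | succ m hm ih =>
    have hm' : (6 : ℝ) ≤ m := by exact_mod_cast hm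
    have hP0 := posWeight_nonneg (m + 1)
    have hPm := posWeight_nonneg m
    refine besselEntire_lt_of_le (z := 28 * m) (by positivity) ?_ (by positivity) ?_ ?_
    · push_cast
      linarith
    · push_cast
      linarith
    set s : ℝ := ((m : ℝ) + 5) / (m + 4) with hs
    have hs1 : 1 ≤ s := by
      rw [hs, one_le_div (by positivity)]
      linarith
    have hs0 : 0 < s := by linarith
    set w : ℝ := ((m : ℝ) + 4) / 4 * (28 * m) with hw
    have hw' : (((m + 1 : ℕ) : ℝ) + 4) / 4 * (28 * m) = s * w := by
      rw [hs, hw]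
      push_cast
      field_simp
      ring
    have hw0 : 0 ≤ w := by positivity
    have hF := besselEntire_pos (by norm_num : (1 : ℝ) ≤ 23 / 2) hw0
    have hgrow := rpow_mul_besselEntire_le (ν := 23 / 2) (w := w) (κ := 5 / 2 * m) (s := s)
      (by norm_num) (by positivity) (by rw [hw]; nlinarith) hs1
    have hW := posWeight_succ_ge (m := m) (by omega)
    have hpow : 45 / 8 ≤ s ^ (23 / 2 : ℝ) * s ^ (5 / 2 * (m : ℝ)) := by
      rw [← Real.rpow_add hs0]
      have h := le_one_add_inv_rpow (M := m + 4) (by omega)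
      have h' : (((m + 4 : ℕ) : ℝ) + 1) / (m + 4 : ℕ) = s := by
        rw [hs]
        push_cast
        ring
      rw [h'] at h
      refine h.trans (Real.rpow_le_rpow_of_exponent_le hs1 ?_)
      push_cast
      linarith
    have hb := besselEntire_pos (by norm_num : (1 : ℝ) ≤ 12) (by positivity : (0 : ℝ) ≤ 28 * m)
    have hc := compCoeff_succ_le (n := m + 1) (by omega)
    rw [hw']
    calc 8192 * compCoeff (m + 1 + 1) * besselEntire 12 (28 * m)
        ≤ 8192 * (45 / 8 * compCoeff (m + 1)) * besselEntire 12 (28 * m) := by gcongr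
      _ = 45 / 8 * (8192 * compCoeff (m + 1) * besselEntire 12 (28 * m)) := by ring
      _ < 45 / 8 * (√π / 1000 * posWeight m * besselEntire (23 / 2) w) := by gcongr
      _ ≤ (s ^ (23 / 2 : ℝ) * s ^ (5 / 2 * (m : ℝ))) *
            (√π / 1000 * posWeight m * besselEntire (23 / 2) w) := by gcongr
      _ = √π / 1000 * (s ^ (23 / 2 : ℝ) * posWeight m) *
            (s ^ (5 / 2 * (m : ℝ)) * besselEntire (23 / 2) w) := by ring
      _ ≤ √π / 1000 * posWeight (m + 1) * besselEntire (23 / 2) (s * w) := by gcongr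

theorem norm_exp_two_pi_I_mul_of_eq {z : ℂ} (x : ℝ) (hz : z = x) :
    ‖Complex.exp (2 * (Real.pi : ℂ) * Complex.I * z)‖ = 1 := by
  rw [hz, show 2 * (Real.pi : ℂ) * Complex.I * (x : ℂ) = ((2 * Real.pi * x : ℝ) : ℂ) * Complex.I by
    push_cast; ring]
  exact Complex.norm_exp_ofReal_mul_I _

theorem norm_psiMult_le {m γ : ℕ} (hm : 0 < m) (hγ : 0 < γ) (δ ℓt ℓ : ℤ) :
    ‖psiMult m γ δ ℓt ℓ‖ ≤ (√(2 * m * γ))⁻¹ * γ := by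
  rw [psiMult, norm_mul]
  have h1 : ‖(((2 * m * γ : ℕ) : ℂ) * Complex.I) ^ (-(1 / 2 : ℂ))‖ = (√(2 * m * γ))⁻¹ := by
    rw [show (-(1 / 2 : ℂ)) = ((-(1 / 2) : ℝ) : ℂ) by push_cast; ring,
      Complex.norm_cpow_real, norm_mul, Complex.norm_I, mul_one, Complex.norm_natCast,
      Real.rpow_neg (by positivity), Real.sqrt_eq_rpow]
    push_cast
    rfl
  rw [h1]
  refine mul_le_mul_of_nonneg_left ?_ (by positivity)
  refine (norm_sum_le_of_le _ (n := fun _ => (1 : ℝ)) fun T _ => ?_).trans (by simp)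
  refine le_of_eq ?_
  refine norm_exp_two_pi_I_mul_of_eq
    ((((((δ : ZMod γ)⁻¹).val : ℕ) : ℝ) * ((ℓt : ℝ) - 2 * m * T) ^ 2) / (4 * m * γ)
      - ((ℓ : ℝ) * ((ℓt : ℝ) - 2 * m * T)) / (2 * m * γ)
      + ((δ : ℝ) * (ℓ : ℝ) ^ 2) / (4 * m * γ)) ?_
  generalize ((δ : ZMod γ)⁻¹).val = α
  push_cast
  ring

theorem norm_Kl_le {m γ : ℕ} (hm : 0 < m) (hγ : 0 < γ) (A B : ℚ) (ℓ ℓt : ℤ) :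
    ‖Kl m A B γ ℓ ℓt‖ ≤ γ * ((√(2 * m * γ))⁻¹ * γ) := by
  rw [Kl]
  refine (norm_sum_le_of_le _ (n := fun _ => (√(2 * m * γ))⁻¹ * γ) fun j _ => ?_).trans ?_
  · rw [norm_mul]
    refine le_trans (le_of_eq ?_) (norm_psiMult_le hm hγ (-(j : ℤ)) ℓt ℓ)
    convert one_mul _ using 2
    refine norm_exp_two_pi_I_mul_of_eq
      (((((-(j : ℤ) : ZMod γ)⁻¹).val : ℕ) : ℝ) * (B : ℝ) / γ +
        ((-(j : ℤ) : ℤ) : ℝ) * (A : ℝ) / γ) ?_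
    generalize ((-(j : ℤ) : ZMod γ)⁻¹).val = α
    push_cast
    ring
  · rw [Finset.sum_const, nsmul_eq_mul]
    refine mul_le_mul_of_nonneg_right ?_ (by positivity)
    exact_mod_cast (Finset.card_filter_le _ _).trans (Finset.card_range γ).le

theorem norm_normalized_Kl_le {m γ : ℕ} (hm : 0 < m) (hγ : 0 < γ) (A B : ℚ) (ℓ ℓt : ℤ) :
    √(2 * m) * ‖Kl m A B γ ℓ ℓt‖ * (γ : ℝ) ^ (-(1 / 2 : ℝ)) ≤ γ := by
  have hγ' : (0 : ℝ) < γ := by exact_mod_cast hγ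
  have hm' : (0 : ℝ) < m := by exact_mod_cast hm
  have hs : √(γ : ℝ) * √(γ : ℝ) = γ := Real.mul_self_sqrt hγ'.le
  have hs0 : 0 < √(γ : ℝ) := Real.sqrt_pos.2 hγ'
  have hm0 : 0 < √(2 * (m : ℝ)) := Real.sqrt_pos.2 (by positivity)
  rw [Real.rpow_neg hγ'.le, ← Real.sqrt_eq_rpow]
  calc √(2 * m) * ‖Kl m A B γ ℓ ℓt‖ * (√(γ : ℝ))⁻¹
      ≤ √(2 * m) * (γ * ((√(2 * m * γ))⁻¹ * γ)) * (√(γ : ℝ))⁻¹ := by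
        gcongr
        exact norm_Kl_le hm hγ A B ℓ ℓt
    _ = γ := by
        rw [Real.sqrt_mul (by positivity : (0 : ℝ) ≤ 2 * m)]
        generalize √(2 * (m : ℝ)) = r at hm0
        generalize √(γ : ℝ) = q at hs hs0
        rw [← hs]
        field_simp

theorem besselI_div_le {x c : ℝ} (hx : 0 < x) (hc : 1 ≤ c) :
    besselI 12 (x / c) ≤ besselI 12 x / c ^ 12 := by
  have hc0 : 0 < c := by linarith
  have h12 : ∀ y : ℝ, y ^ (12 : ℝ) = y ^ 12 := fun y => by exact_mod_cast Real.rpow_natCast y 12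
  rw [besselI_eq_besselEntire 12 (div_pos hx hc0), besselI_eq_besselEntire 12 hx, h12, h12]
  have hle : x / c ≤ x := div_le_self hx.le hc
  have := besselEntire_mono (by norm_num : (1 : ℝ) ≤ 12) (by positivity : 0 ≤ (x / c / 2) ^ 2)
    (by gcongr : (x / c / 2) ^ 2 ≤ (x / 2) ^ 2)
  calc (x / c / 2) ^ 12 * besselEntire 12 ((x / c / 2) ^ 2)
      ≤ (x / c / 2) ^ 12 * besselEntire 12 ((x / 2) ^ 2) := by gcongr
    _ = _ := by
      field_simp

theorem besselI_nonneg {x : ℝ} (hx : 0 < x) : 0 ≤ besselI 12 x := by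
  rw [besselI_eq_besselEntire 12 hx]
  have := besselEntire_pos (by norm_num : (1 : ℝ) ≤ 12) (by positivity : 0 ≤ (x / 2) ^ 2)
  positivity

theorem mul_besselI_twelve_eq {m : ℕ} {D : ℝ} (hm : 0 < m) (hD : 0 < D) :
    (4 * (m : ℝ) / D) ^ 6 * besselI 12 (2 * π * √(D / m)) =
      4096 * π ^ 12 * besselEntire 12 (π ^ 2 * D / m) := by
  have hm' : (0 : ℝ) < m := by exact_mod_cast hm
  have hs : √(D / m) ^ 2 = D / m := Real.sq_sqrt (by positivity)
  have hx : 0 < 2 * π * √(D / m) := by positivity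
  have hsq : (2 * π * √(D / m) / 2) ^ 2 = π ^ 2 * D / m := by
    rw [show 2 * π * √(D / m) / 2 = π * √(D / m) by ring, mul_pow, hs]
    ring
  have h12 : (2 * π * √(D / m) / 2) ^ (12 : ℝ) = (π ^ 2 * D / m) ^ 6 := by
    rw [← hsq, ← pow_mul]
    exact_mod_cast Real.rpow_natCast _ 12
  rw [besselI_eq_besselEntire 12 hx, h12, hsq]
  field_simp
  norm_num
  ring

theorem Cpos_eq {m : ℕ} {Δ : ℤ} (hm : 0 < m) (hΔ : 0 < Δ) :
    Cpos m Δ = 2 * √π * π ^ 12 * posWeight m *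
      besselEntire (23 / 2) (((m : ℝ) + 4) / 4 * (π ^ 2 * Δ / m)) := by
  have hm' : (0 : ℝ) < m := by exact_mod_cast hm
  have hD : (0 : ℝ) < Δ := by exact_mod_cast hΔ
  set y := π * √((Δ : ℝ) * (4 * (m : ℝ) + (m : ℝ) ^ 2)) / m with hy
  have hy0 : 0 < y := by positivity
  have hsq : (y / 2) ^ 2 = ((m : ℝ) + 4) / 4 * (π ^ 2 * Δ / m) := by
    rw [hy, div_pow, div_pow, mul_pow, Real.sq_sqrt (by positivity)]
    field_simp
    ring
  have hpow : ((4 * (m : ℝ) + (m : ℝ) ^ 2) / Δ) ^ ((23 : ℝ) / 4) * (y / 2) ^ (23 / 2 : ℝ) =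
      π ^ (23 / 2 : ℝ) * (((m : ℝ) + 4) / 2) ^ (23 / 2 : ℝ) := by
    have h1 : (y / 2) ^ (23 / 2 : ℝ) = ((y / 2) ^ 2) ^ (23 / 4 : ℝ) := by
      rw [← Real.rpow_natCast, ← Real.rpow_mul (by positivity)]
      norm_num
    rw [h1, hsq, ← Real.mul_rpow (by positivity) (by positivity),
      ← Real.mul_rpow (by positivity) (by positivity),
      show (4 * (m : ℝ) + (m : ℝ) ^ 2) / Δ * (((m : ℝ) + 4) / 4 * (π ^ 2 * Δ / m)) =
        (π * (((m : ℝ) + 4) / 2)) ^ 2 by field_simp; ring,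
      ← Real.rpow_natCast, ← Real.rpow_mul (by positivity)]
    norm_num
  have hpi : π * π ^ (23 / 2 : ℝ) = √π * π ^ 12 := by
    rw [Real.sqrt_eq_rpow, ← Real.rpow_natCast, ← Real.rpow_add Real.pi_pos]
    nth_rewrite 1 [← Real.rpow_one π]
    rw [← Real.rpow_add Real.pi_pos]
    norm_num
  have hm2 : (2 * (m : ℝ)) ^ (-(1 / 2 : ℝ)) = (√(2 * m))⁻¹ := by
    rw [Real.rpow_neg (by positivity), Real.sqrt_eq_rpow]
  rw [Cpos, ← hy, besselI_eq_besselEntire _ hy0, hsq, hm2, posWeight]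
  calc _ = 2 * π * ((m : ℝ) + 2) * (√(2 * m))⁻¹ *
        (((4 * (m : ℝ) + (m : ℝ) ^ 2) / Δ) ^ ((23 : ℝ) / 4) * (y / 2) ^ (23 / 2 : ℝ)) *
        besselEntire (23 / 2) (((m : ℝ) + 4) / 4 * (π ^ 2 * Δ / m)) := by ring
    _ = 2 * (π * π ^ (23 / 2 : ℝ)) * (((m : ℝ) + 2) * (√(2 * m))⁻¹ *
        (((m : ℝ) + 4) / 2) ^ (23 / 2 : ℝ)) *
        besselEntire (23 / 2) (((m : ℝ) + 4) / 4 * (π ^ 2 * Δ / m)) := by rw [hpow]; ring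
    _ = _ := by rw [hpi]; ring

theorem two_mul_dcoef_mul_lt {m : ℕ} (hm : 6 ≤ m) {Δ : ℤ} (hΔ : 3 * (m : ℤ) ^ 2 ≤ Δ) :
    2 * ((dcoef m : ℝ) * ((4 * (m : ℝ) / Δ) ^ 6 * besselI 12 (2 * π * √((Δ : ℝ) / m)))) <
      5 / 10000 * Cpos m Δ := by
  have hm0 : 0 < m := by omega
  have hm' : (0 : ℝ) < m := by exact_mod_cast hm0
  have hΔ' : 3 * (m : ℝ) ^ 2 ≤ Δ := by exact_mod_cast hΔ
  have hD : (0 : ℝ) < Δ := lt_of_lt_of_le (by positivity) hΔ'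
  rw [mul_besselI_twelve_eq hm0 hD, Cpos_eq hm0 (by exact_mod_cast hD)]
  set z := π ^ 2 * Δ / m with hz
  have hz28 : 28 * (m : ℝ) ≤ z := by
    rw [hz, le_div_iff₀ hm']
    have hpi : 28 / 3 ≤ π ^ 2 := by nlinarith [Real.pi_gt_d2]
    nlinarith [mul_le_mul hpi hΔ' (by positivity) (by positivity)]
  have hP := posWeight_nonneg m
  have hm6 : (6 : ℝ) ≤ m := by exact_mod_cast hm
  have hmain := besselEntire_lt_of_le (by positivity) (by linarith) (by positivity) hz28
    (besselEntire_estimate hm)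
  have hF := besselEntire_pos (by norm_num : (1 : ℝ) ≤ 12) (by positivity : 0 ≤ z)
  have hpi12 : 0 < π ^ 12 := by positivity
  calc 2 * ((dcoef m : ℝ) * (4096 * π ^ 12 * besselEntire 12 z))
      ≤ 2 * (compCoeff (m + 1) * (4096 * π ^ 12 * besselEntire 12 z)) := by
        gcongr
        exact dcoef_le_compCoeff m
    _ = π ^ 12 * (8192 * compCoeff (m + 1) * besselEntire 12 z) := by ring
    _ < π ^ 12 * (√π / 1000 * posWeight m * besselEntire (23 / 2) (((m : ℝ) + 4) / 4 * z)) := by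
        gcongr
    _ = _ := by ring

theorem hasSum_one_div_succ_sq : HasSum (fun n : ℕ => 1 / ((n : ℝ) + 1) ^ 2) (π ^ 2 / 6) := by
  have h := (hasSum_nat_add_iff' 1).2 hasSum_zeta_two
  simpa using h

theorem stmt7 (m : ℕ) (hm : 6 ≤ m) (n ℓ : ℤ) (hn : (m : ℤ) ≤ n)
    (hℓ0 : 0 ≤ ℓ) (hℓm : ℓ ≤ (m : ℤ)) :
    Summable (fun γ : ℕ =>
      ((Real.sqrt (2 * m) * (dcoef m : ℝ) : ℝ) : ℂ) *
        Kl m (((4 * (m : ℤ) * n - ℓ ^ 2 : ℤ) : ℚ) / (4 * m)) (-1) (γ + 1) ℓ 0 *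
        (((((γ : ℕ) + 1 : ℕ) : ℝ) ^ (-(1 / 2 : ℝ)) : ℝ) : ℂ) *
        ((((4 * (m : ℝ)) / ((4 * (m : ℤ) * n - ℓ ^ 2 : ℤ) : ℝ)) ^ 6 *
          besselI 12 (2 * Real.pi * Real.sqrt (((4 * (m : ℤ) * n - ℓ ^ 2 : ℤ) : ℝ) / m) /
            (((γ : ℕ) + 1 : ℕ) : ℝ)) : ℝ) : ℂ)) ∧
    ‖∑' γ : ℕ,
        ((Real.sqrt (2 * m) * (dcoef m : ℝ) : ℝ) : ℂ) *
        Kl m (((4 * (m : ℤ) * n - ℓ ^ 2 : ℤ) : ℚ) / (4 * m)) (-1) (γ + 1) ℓ 0 *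
        (((((γ : ℕ) + 1 : ℕ) : ℝ) ^ (-(1 / 2 : ℝ)) : ℝ) : ℂ) *
        ((((4 * (m : ℝ)) / ((4 * (m : ℤ) * n - ℓ ^ 2 : ℤ) : ℝ)) ^ 6 *
          besselI 12 (2 * Real.pi * Real.sqrt (((4 * (m : ℤ) * n - ℓ ^ 2 : ℤ) : ℝ) / m) /
            (((γ : ℕ) + 1 : ℕ) : ℝ)) : ℝ) : ℂ)‖ <
      (5 / 10000) * Cpos m (4 * (m : ℤ) * n - ℓ ^ 2) := by
  have hm0 : 0 < m := by omega
  have hm' : (0 : ℝ) < m := by exact_mod_cast hm0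
  have hΔ : 3 * (m : ℤ) ^ 2 ≤ 4 * (m : ℤ) * n - ℓ ^ 2 := by nlinarith
  set Δ : ℤ := 4 * (m : ℤ) * n - ℓ ^ 2 with hΔdef
  have hD : (0 : ℝ) < Δ := by
    have : 3 * (m : ℝ) ^ 2 ≤ Δ := by exact_mod_cast hΔ
    exact lt_of_lt_of_le (by positivity) this
  set x := 2 * π * √((Δ : ℝ) / m) with hx
  have hx0 : 0 < x := by positivity
  have hd : (0 : ℝ) ≤ dcoef m := by exact_mod_cast dcoef_nonneg m
  have hI := besselI_nonneg hx0
  set K := (dcoef m : ℝ) * ((4 * (m : ℝ) / Δ) ^ 6 * besselI 12 x) with hK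
  have hK0 : 0 ≤ K := by positivity
  have hsum := hasSum_one_div_succ_sq.mul_left K
  have hbound : ∀ γ : ℕ, ‖((Real.sqrt (2 * m) * (dcoef m : ℝ) : ℝ) : ℂ) *
      Kl m ((Δ : ℚ) / (4 * m)) (-1) (γ + 1) ℓ 0 *
      (((((γ : ℕ) + 1 : ℕ) : ℝ) ^ (-(1 / 2 : ℝ)) : ℝ) : ℂ) *
      ((((4 * (m : ℝ)) / (Δ : ℝ)) ^ 6 *
        besselI 12 (x / (((γ : ℕ) + 1 : ℕ) : ℝ)) : ℝ) : ℂ)‖ ≤ K * (1 / ((γ : ℝ) + 1) ^ 2) := by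
    intro γ
    have hc1 : (1 : ℝ) ≤ ((γ + 1 : ℕ) : ℝ) := by exact_mod_cast Nat.le_add_left 1 γ
    have hc0 : (0 : ℝ) < ((γ + 1 : ℕ) : ℝ) := by linarith
    have hB := besselI_div_le hx0 hc1
    have hB0 := besselI_nonneg (div_pos hx0 hc0)
    have hKl := norm_normalized_Kl_le hm0 γ.succ_pos ((Δ : ℚ) / (4 * m)) (-1) ℓ 0
    rw [norm_mul, norm_mul, norm_mul, Complex.norm_real, Complex.norm_real, Complex.norm_real,
      Real.norm_of_nonneg (by positivity), Real.norm_of_nonneg (by positivity),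
      Real.norm_of_nonneg (by positivity)]
    have hcast : (γ : ℝ) + 1 = ((γ + 1 : ℕ) : ℝ) := by push_cast; rfl
    rw [hcast]
    set c := ((γ + 1 : ℕ) : ℝ) with hc
    calc _ = (√(2 * m) * ‖Kl m ((Δ : ℚ) / (4 * m)) (-1) (γ + 1) ℓ 0‖ * c ^ (-(1 / 2 : ℝ))) *
          ((dcoef m : ℝ) * ((4 * (m : ℝ) / Δ) ^ 6 * besselI 12 (x / c))) := by ring
      _ ≤ c * ((dcoef m : ℝ) * ((4 * (m : ℝ) / Δ) ^ 6 * (besselI 12 x / c ^ 12))) := by gcongr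
      _ = K * (1 / c ^ 11) := by
          rw [hK]
          field_simp
      _ ≤ K * (1 / c ^ 2) := by
          gcongr
          norm_num
  have hlt := two_mul_dcoef_mul_lt hm hΔ
  rw [← hx, ← hK] at hlt
  refine ⟨Summable.of_norm_bounded hsum.summable hbound, ?_⟩
  refine lt_of_le_of_lt (tsum_of_norm_bounded hsum hbound) (lt_of_le_of_lt ?_ hlt)
  have hpi : π ^ 2 / 6 ≤ 2 := by nlinarith [Real.pi_lt_d2, Real.pi_pos]
  nlinarith
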